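/- Let Ω ⊆ ℝ² be open, let f : (0,∞) → ℝ be C², and let (u,m) be a classical solution of the 1D MFG system with coupling f on Ω. Then the function w = f∘m satisfies, at every point of Ω, the equation −w_{tt} + 2·u_x·w_{xt} − (u_x² + m·f'(m))·w_{xx} − (w_x)² + m·(m·f''(m) + 2·f'(m))·u_{xx}² = 0. -/

import Mathlib

/-- Partial derivative in the first (space) variable. -/
noncomputable def pdx (u : ℝ → ℝ → ℝ) (x t : ℝ) : ℝ := deriv (fun y => u y t) x

/-- Partial derivative in the second (time) variable. -/
noncomputable def pdt (u : ℝ → ℝ → ℝ) (x t : ℝ) : ℝ := deriv (fun s => u x s) t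

open scoped ContDiff

section PartialDerivatives

variable {g h : ℝ → ℝ → ℝ} {Ω : Set (ℝ × ℝ)} {x t : ℝ}

theorem hasDerivAt_slice_fst (hg : DifferentiableAt ℝ (fun p : ℝ × ℝ => g p.1 p.2) (x, t)) :
    HasDerivAt (fun y => g y t) (fderiv ℝ (fun p : ℝ × ℝ => g p.1 p.2) (x, t) (1, 0)) x :=
  HasFDerivAt.comp_hasDerivAt (f := fun y : ℝ => (y, t)) x hg.hasFDerivAt
    ((hasDerivAt_id x).prodMk (hasDerivAt_const x t))

theorem hasDerivAt_slice_snd (hg : DifferentiableAt ℝ (fun p : ℝ × ℝ => g p.1 p.2) (x, t)) :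
    HasDerivAt (fun s => g x s) (fderiv ℝ (fun p : ℝ × ℝ => g p.1 p.2) (x, t) (0, 1)) t :=
  HasFDerivAt.comp_hasDerivAt (f := fun s : ℝ => (x, s)) t hg.hasFDerivAt
    ((hasDerivAt_const t x).prodMk (hasDerivAt_id t))

theorem pdx_eq_fderiv (hg : DifferentiableAt ℝ (fun p : ℝ × ℝ => g p.1 p.2) (x, t)) :
    pdx g x t = fderiv ℝ (fun p : ℝ × ℝ => g p.1 p.2) (x, t) (1, 0) :=
  (hasDerivAt_slice_fst hg).deriv

theorem pdt_eq_fderiv (hg : DifferentiableAt ℝ (fun p : ℝ × ℝ => g p.1 p.2) (x, t)) :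
    pdt g x t = fderiv ℝ (fun p : ℝ × ℝ => g p.1 p.2) (x, t) (0, 1) :=
  (hasDerivAt_slice_snd hg).deriv

theorem differentiableAt_of_smoothOn (hΩ : IsOpen Ω)
    (hg : ContDiffOn ℝ ∞ (fun p : ℝ × ℝ => g p.1 p.2) Ω) (hp : (x, t) ∈ Ω) :
    DifferentiableAt ℝ (fun p : ℝ × ℝ => g p.1 p.2) (x, t) :=
  (hg.differentiableOn (by simp)).differentiableAt (hΩ.mem_nhds hp)

theorem hasDerivAt_pdx (hΩ : IsOpen Ω)
    (hg : ContDiffOn ℝ ∞ (fun p : ℝ × ℝ => g p.1 p.2) Ω) (hp : (x, t) ∈ Ω) :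
    HasDerivAt (fun y => g y t) (pdx g x t) x :=
  (hasDerivAt_slice_fst (differentiableAt_of_smoothOn hΩ hg hp)).differentiableAt.hasDerivAt

theorem hasDerivAt_pdt (hΩ : IsOpen Ω)
    (hg : ContDiffOn ℝ ∞ (fun p : ℝ × ℝ => g p.1 p.2) Ω) (hp : (x, t) ∈ Ω) :
    HasDerivAt (fun s => g x s) (pdt g x t) t :=
  (hasDerivAt_slice_snd (differentiableAt_of_smoothOn hΩ hg hp)).differentiableAt.hasDerivAt

theorem contDiffOn_pdx (hΩ : IsOpen Ω)
    (hg : ContDiffOn ℝ ∞ (fun p : ℝ × ℝ => g p.1 p.2) Ω) :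
    ContDiffOn ℝ ∞ (fun p : ℝ × ℝ => pdx g p.1 p.2) Ω :=
  ((hg.fderiv_of_isOpen (m := ∞) hΩ (by simp)).clm_apply contDiffOn_const).congr
    fun _ hp => pdx_eq_fderiv (differentiableAt_of_smoothOn hΩ hg hp)

theorem contDiffOn_pdt (hΩ : IsOpen Ω)
    (hg : ContDiffOn ℝ ∞ (fun p : ℝ × ℝ => g p.1 p.2) Ω) :
    ContDiffOn ℝ ∞ (fun p : ℝ × ℝ => pdt g p.1 p.2) Ω :=
  ((hg.fderiv_of_isOpen (m := ∞) hΩ (by simp)).clm_apply contDiffOn_const).congr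
    fun _ hp => pdt_eq_fderiv (differentiableAt_of_smoothOn hΩ hg hp)

theorem pdx_congr (hΩ : IsOpen Ω) (hgh : ∀ x t : ℝ, (x, t) ∈ Ω → g x t = h x t)
    (hp : (x, t) ∈ Ω) : pdx g x t = pdx h x t := by
  refine Filter.EventuallyEq.deriv_eq ?_
  have hc : ContinuousAt (fun y : ℝ => (y, t)) x := by fun_prop
  filter_upwards [hc.preimage_mem_nhds (hΩ.mem_nhds hp)] with y hy using hgh y t hy

theorem pdt_congr (hΩ : IsOpen Ω) (hgh : ∀ x t : ℝ, (x, t) ∈ Ω → g x t = h x t)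
    (hp : (x, t) ∈ Ω) : pdt g x t = pdt h x t := by
  refine Filter.EventuallyEq.deriv_eq ?_
  have hc : ContinuousAt (fun s : ℝ => (x, s)) t := by fun_prop
  filter_upwards [hc.preimage_mem_nhds (hΩ.mem_nhds hp)] with s hs using hgh x s hs

theorem pdt_pdx_comm (hΩ : IsOpen Ω)
    (hg : ContDiffOn ℝ ∞ (fun p : ℝ × ℝ => g p.1 p.2) Ω) (hp : (x, t) ∈ Ω) :
    pdt (pdx g) x t = pdx (pdt g) x t := by
  set G : ℝ × ℝ → ℝ := fun p => g p.1 p.2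
  have hG : DifferentiableAt ℝ (fderiv ℝ G) (x, t) :=
    ((hg.fderiv_of_isOpen (m := ∞) hΩ (by simp)).differentiableOn (by simp)).differentiableAt
      (hΩ.mem_nhds hp)
  have happly (v : ℝ × ℝ) : HasFDerivAt (fun p : ℝ × ℝ => fderiv ℝ G (p.1, p.2) v)
      ((fderiv ℝ (fderiv ℝ G) (x, t)).flip v) (x, t) := by
    simpa using hG.hasFDerivAt.clm_apply (hasFDerivAt_const v (x, t))
  have hsymm : IsSymmSndFDerivAt ℝ G (x, t) :=
    (hg.contDiffAt (hΩ.mem_nhds hp)).isSymmSndFDerivAt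
      (by rw [minSmoothness_of_isRCLikeNormedField]; exact WithTop.coe_le_coe.2 le_top)
  rw [pdt_congr (h := fun y s => fderiv ℝ G (y, s) (1, 0)) hΩ
      (fun y s hq => pdx_eq_fderiv (differentiableAt_of_smoothOn hΩ hg hq)) hp,
    pdx_congr (h := fun y s => fderiv ℝ G (y, s) (0, 1)) hΩ
      (fun y s hq => pdt_eq_fderiv (differentiableAt_of_smoothOn hΩ hg hq)) hp,
    pdt_eq_fderiv (happly _).differentiableAt, pdx_eq_fderiv (happly _).differentiableAt,
    (happly _).fderiv, (happly _).fderiv]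
  exact hsymm.eq _ _

end PartialDerivatives

/-- For a classical solution `(u, m)` of the 1D MFG system with C² coupling `f` on an open
set `Ω`, the function `w = f ∘ m` satisfies
`-w_tt + 2 u_x w_xt - (u_x² + m f'(m)) w_xx - w_x² + m (m f''(m) + 2 f'(m)) u_xx² = 0`. -/
theorem stmt2
    (Ω : Set (ℝ × ℝ)) (hΩ : IsOpen Ω)
    (f : ℝ → ℝ) (hf : ContDiffOn ℝ 2 f (Set.Ioi 0))
    (u m : ℝ → ℝ → ℝ)
    (hu : ContDiffOn ℝ (⊤ : ℕ∞) (fun p : ℝ × ℝ => u p.1 p.2) Ω)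
    (hm : ContDiffOn ℝ (⊤ : ℕ∞) (fun p : ℝ × ℝ => m p.1 p.2) Ω)
    (hmpos : ∀ x t : ℝ, (x, t) ∈ Ω → 0 < m x t)
    (hHJ : ∀ x t : ℝ, (x, t) ∈ Ω →
      -pdt u x t + (1/2) * (pdx u x t)^2 = f (m x t))
    (hCE : ∀ x t : ℝ, (x, t) ∈ Ω →
      pdt m x t - pdx (fun y s => m y s * pdx u y s) x t = 0)
    (w : ℝ → ℝ → ℝ) (hw : ∀ x t : ℝ, w x t = f (m x t)) :
    ∀ x t : ℝ, (x, t) ∈ Ω →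
      -pdt (pdt w) x t + 2 * pdx u x t * pdt (pdx w) x t
        - ((pdx u x t)^2 + m x t * deriv f (m x t)) * pdx (pdx w) x t
        - (pdx w x t)^2
        + m x t * (m x t * deriv (deriv f) (m x t) + 2 * deriv f (m x t))
            * (pdx (pdx u) x t)^2 = 0 := by
  have hf' : ContDiffOn ℝ 1 (deriv f) (Set.Ioi 0) :=
    hf.deriv_of_isOpen isOpen_Ioi (by norm_num)
  have hdf (r : ℝ) (hr : 0 < r) : HasDerivAt f (deriv f r) r :=
    ((hf.differentiableOn (by simp)).differentiableAt (isOpen_Ioi.mem_nhds hr)).hasDerivAt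
  have hddf (r : ℝ) (hr : 0 < r) : HasDerivAt (deriv f) (deriv (deriv f) r) r :=
    ((hf'.differentiableOn (by simp)).differentiableAt (isOpen_Ioi.mem_nhds hr)).hasDerivAt
  have hux := contDiffOn_pdx hΩ hu
  have hut := contDiffOn_pdt hΩ hu
  have huxx := contDiffOn_pdx hΩ hux
  have hwu (x t : ℝ) (hp : (x, t) ∈ Ω) : w x t = -pdt u x t + (1/2) * (pdx u x t)^2 := by
    rw [hw, hHJ x t hp]
  have hwsmooth : ContDiffOn ℝ (⊤ : ℕ∞) (fun p : ℝ × ℝ => w p.1 p.2) Ω :=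
    (hut.neg.add (contDiffOn_const.mul (hux.pow 2))).congr fun p hp => hwu p.1 p.2 hp
  have hwx := contDiffOn_pdx hΩ hwsmooth
  have hmt (x t : ℝ) (hp : (x, t) ∈ Ω) :
      pdt m x t = pdx m x t * pdx u x t + m x t * pdx (pdx u) x t :=
    (sub_eq_zero.mp (hCE x t hp)).trans
      ((hasDerivAt_pdx hΩ hm hp).mul (hasDerivAt_pdx hΩ hux hp)).deriv
  have hwx_eq (x t : ℝ) (hp : (x, t) ∈ Ω) :
      pdx w x t = -pdt (pdx u) x t + pdx u x t * pdx (pdx u) x t := by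
    rw [pdx_congr hΩ hwu hp, pdt_pdx_comm hΩ hu hp]
    refine (((hasDerivAt_pdx hΩ hut hp).neg.add
      (((hasDerivAt_pdx hΩ hux hp).pow 2).const_mul (1 / 2))).congr_deriv ?_).deriv
    norm_num
    ring
  have hwx_comp (x t : ℝ) (hp : (x, t) ∈ Ω) :
      pdx w x t = deriv f (m x t) * pdx m x t := by
    rw [pdx_congr hΩ (fun x t _ => hw x t) hp]
    exact ((hdf _ (hmpos x t hp)).comp x (hasDerivAt_pdx hΩ hm hp)).deriv
  have hwt_eq (x t : ℝ) (hp : (x, t) ∈ Ω) :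
      pdt w x t = pdx u x t * pdx w x t + m x t * deriv f (m x t) * pdx (pdx u) x t := by
    rw [pdt_congr hΩ (fun x t _ => hw x t) hp, hwx_comp x t hp]
    refine (((hdf _ (hmpos x t hp)).comp t (hasDerivAt_pdt hΩ hm hp)).congr_deriv ?_).deriv
    rw [hmt x t hp]
    ring
  intro x t hp
  have hpos := hmpos x t hp
  have hwxx : pdx (pdx w) x t = -pdt (pdx (pdx u)) x t
      + (pdx (pdx u) x t * pdx (pdx u) x t + pdx u x t * pdx (pdx (pdx u)) x t) := by
    rw [pdx_congr hΩ hwx_eq hp, pdt_pdx_comm hΩ hux hp]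
    exact ((hasDerivAt_pdx hΩ (contDiffOn_pdt hΩ hux) hp).neg.add
      ((hasDerivAt_pdx hΩ hux hp).mul (hasDerivAt_pdx hΩ huxx hp))).deriv
  have hwtt : pdt (pdt w) x t =
      pdt (pdx u) x t * pdx w x t + pdx u x t * pdt (pdx w) x t
      + ((pdt m x t * deriv f (m x t) + m x t * (deriv (deriv f) (m x t) * pdt m x t))
          * pdx (pdx u) x t + m x t * deriv f (m x t) * pdt (pdx (pdx u)) x t) := by
    rw [pdt_congr hΩ hwt_eq hp]
    exact (((hasDerivAt_pdt hΩ hux hp).mul (hasDerivAt_pdt hΩ hwx hp)).add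
      (((hasDerivAt_pdt hΩ hm hp).mul ((hddf _ hpos).comp t (hasDerivAt_pdt hΩ hm hp))).mul
        (hasDerivAt_pdt hΩ huxx hp))).deriv
  have hwxt : pdt (pdx w) x t =
      pdx (pdx u) x t * pdx w x t + pdx u x t * pdx (pdx w) x t
      + ((pdx m x t * deriv f (m x t) + m x t * (deriv (deriv f) (m x t) * pdx m x t))
          * pdx (pdx u) x t + m x t * deriv f (m x t) * pdx (pdx (pdx u)) x t) := by
    rw [pdt_pdx_comm hΩ hwsmooth hp, pdx_congr hΩ hwt_eq hp]
    exact (((hasDerivAt_pdx hΩ hux hp).mul (hasDerivAt_pdx hΩ hwx hp)).add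
      (((hasDerivAt_pdx hΩ hm hp).mul ((hddf _ hpos).comp x (hasDerivAt_pdx hΩ hm hp))).mul
        (hasDerivAt_pdx hΩ huxx hp))).deriv
  have huxt : pdt (pdx u) x t = pdx u x t * pdx (pdx u) x t - pdx w x t := by
    linear_combination hwx_eq x t hp
  have huxxt : pdt (pdx (pdx u)) x t = pdx (pdx u) x t * pdx (pdx u) x t
      + pdx u x t * pdx (pdx (pdx u)) x t - pdx (pdx w) x t := by
    linear_combination hwxx
  rw [hwtt, huxt, huxxt, hmt x t hp]
  linear_combination pdx u x t * hwxt
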